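/- arXiv:2204.04326 — 4 statements merged into one kernel-verified Lean document; each statement's English description precedes it below -/
import Mathlib

section
/- For every nonnegative integer k and every δ ∈ (0,1) there exists a constant C(k,δ) > 0 such that for all τ > 0, all t ∈ [0,1] and all u, v, y ∈ [0,∞), the k-th derivative in t of the function t ↦ p_B(τ; t·u+(1−t)·v, y) satisfies |d^k/dt^k p_B(τ; t·u+(1−t)·v, y)| ≤ C(k,δ) · |u−v|^k · τ^{−k/2} · p_B((1+δ)·τ; t·u+(1−t)·v, y). -/
open Real MeasureTheory Set

/-- One-dimensional heat kernel `p_B(τ; z, z') = (2πτ)^{-1/2} exp(-(z-z')²/(2τ))`. -/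
noncomputable def pB (τ z z' : ℝ) : ℝ :=
  Real.exp (-(z - z') ^ 2 / (2 * τ)) / Real.sqrt (2 * Real.pi * τ)

theorem exists_abs_eval_mul_exp_neg_sq_le (p : Polynomial ℝ) {c : ℝ} (hc : 0 < c) :
    ∃ M > 0, ∀ x : ℝ, |p.eval x| * Real.exp (-(c * x ^ 2)) ≤ M := by
  induction p using Polynomial.induction_on' with
  | add p q hp hq =>
    obtain ⟨M, hM, hp⟩ := hp
    obtain ⟨N, hN, hq⟩ := hq
    refine ⟨M + N, by positivity, fun x => ?_⟩
    rw [Polynomial.eval_add]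
    calc |p.eval x + q.eval x| * Real.exp (-(c * x ^ 2))
        ≤ (|p.eval x| + |q.eval x|) * Real.exp (-(c * x ^ 2)) := by
          gcongr
          exact abs_add_le _ _
      _ ≤ M + N := by linarith [hp x, hq x]
  | monomial n a =>
    refine ⟨(|a| + 1) * (1 + n.factorial / c ^ n), by positivity, fun x => ?_⟩
    have hpow : |x| ^ n ≤ 1 + (x ^ 2) ^ n := by
      rw [← sq_abs, ← pow_mul, mul_comm 2 n, pow_mul]
      nlinarith [sq_nonneg (|x| ^ n - 1), pow_nonneg (abs_nonneg x) n]
    have hfac : (x ^ 2) ^ n ≤ n.factorial / c ^ n * Real.exp (c * x ^ 2) := by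
      have h := Real.pow_div_factorial_le_exp (c * x ^ 2) (by positivity) n
      rw [div_le_iff₀ (by positivity), mul_pow] at h
      rw [div_mul_eq_mul_div, le_div_iff₀ (by positivity)]
      linarith
    have hone : 1 ≤ Real.exp (c * x ^ 2) := Real.one_le_exp (by positivity)
    rw [Polynomial.eval_monomial, Real.exp_neg, ← div_eq_mul_inv,
      div_le_iff₀ (Real.exp_pos _), abs_mul, abs_pow]
    calc |a| * |x| ^ n
        ≤ (|a| + 1) * (Real.exp (c * x ^ 2) + n.factorial / c ^ n * Real.exp (c * x ^ 2)) := by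
          gcongr
          · linarith
          · linarith
      _ = _ := by ring

theorem exists_abs_iteratedDeriv_gaussian_le (k : ℕ) {b : ℝ} (hb : b < 1 / 2) :
    ∃ M > 0, ∀ x : ℝ, |iteratedDeriv k (fun y : ℝ => Real.exp (-(y ^ 2 / 2))) x| ≤
      M * Real.exp (-(b * x ^ 2)) := by
  obtain ⟨M, hM, h⟩ := exists_abs_eval_mul_exp_neg_sq_le
    ((Polynomial.hermite k).map (algebraMap ℤ ℝ)) (sub_pos.2 hb)
  refine ⟨M, hM, fun x => ?_⟩
  have hexp : Real.exp (-(x ^ 2 / 2)) =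
      Real.exp (-((1 / 2 - b) * x ^ 2)) * Real.exp (-(b * x ^ 2)) := by
    rw [← Real.exp_add]
    congr 1
    ring
  rw [iteratedDeriv_eq_iterate, Polynomial.deriv_gaussian_eq_hermite_mul_gaussian, abs_mul,
    abs_mul, abs_pow, abs_neg, abs_one, one_pow, one_mul, Real.abs_exp, hexp, ← mul_assoc,
    ← Polynomial.eval_map_algebraMap]
  gcongr
  exact h x

theorem pB_eq_gaussian {τ : ℝ} (hτ : 0 < τ) (z z' : ℝ) :
    pB τ z z' =
      (Real.sqrt (2 * Real.pi * τ))⁻¹ * Real.exp (-(((z - z') / Real.sqrt τ) ^ 2 / 2)) := by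
  rw [pB, div_eq_inv_mul, div_pow, Real.sq_sqrt hτ.le]
  congr 2
  field_simp

theorem iteratedDeriv_comp_mul_add (k : ℕ) {f : ℝ → ℝ} (hf : ContDiff ℝ k f) (a b t : ℝ) :
    iteratedDeriv k (fun s => f (a * s + b)) t = a ^ k * iteratedDeriv k f (a * t + b) := by
  have h := iteratedDeriv_comp_const_mul (f := fun x => f (x + b))
    (hf.comp (contDiff_id.add contDiff_const)) a
  rw [h, iteratedDeriv_comp_add_const]

theorem deriv_heat_kernel_bound (k : ℕ) (δ : ℝ) (hδ : δ ∈ Set.Ioo (0 : ℝ) 1) :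
    ∃ C > 0, ∀ τ > (0 : ℝ), ∀ t ∈ Set.Icc (0 : ℝ) 1,
      ∀ u ∈ Set.Ici (0 : ℝ), ∀ v ∈ Set.Ici (0 : ℝ), ∀ y ∈ Set.Ici (0 : ℝ),
        |iteratedDeriv k (fun s => pB τ (s * u + (1 - s) * v) y) t| ≤
          C * |u - v| ^ k * τ ^ (-(k : ℝ) / 2) *
            pB ((1 + δ) * τ) (t * u + (1 - t) * v) y := by
  have hδ0 : 0 < δ := hδ.1
  have hb : 1 / (2 * (1 + δ)) < 1 / 2 := by
    apply one_div_lt_one_div_of_lt <;> linarith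
  obtain ⟨M, hM, h⟩ := exists_abs_iteratedDeriv_gaussian_le k hb
  refine ⟨M * Real.sqrt (1 + δ), by positivity, fun τ hτ t _ u _ v _ y _ => ?_⟩
  have hτ0 : 0 < τ := hτ
  have hs : 0 < Real.sqrt τ := Real.sqrt_pos.2 hτ0
  have harg (s : ℝ) : (s * u + (1 - s) * v - y) / Real.sqrt τ =
      (u - v) / Real.sqrt τ * s + (v - y) / Real.sqrt τ := by ring
  have hrpow : τ ^ (-(k : ℝ) / 2) = (Real.sqrt τ ^ k)⁻¹ := by
    rw [Real.sqrt_eq_rpow, ← Real.rpow_mul_natCast hτ0.le, ← Real.rpow_neg hτ0.le]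
    congr 1
    ring
  have hker : Real.sqrt (1 + δ) * pB ((1 + δ) * τ) (t * u + (1 - t) * v) y =
      (Real.sqrt (2 * Real.pi * τ))⁻¹ * Real.exp (-(1 / (2 * (1 + δ)) *
        ((t * u + (1 - t) * v - y) / Real.sqrt τ) ^ 2)) := by
    have hsplit : Real.sqrt (2 * Real.pi * ((1 + δ) * τ)) =
        Real.sqrt (1 + δ) * Real.sqrt (2 * Real.pi * τ) := by
      rw [← Real.sqrt_mul (by positivity)]
      congr 1
      ring
    have hexp : -(t * u + (1 - t) * v - y) ^ 2 / (2 * ((1 + δ) * τ)) =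
        -(1 / (2 * (1 + δ)) * ((t * u + (1 - t) * v - y) / Real.sqrt τ) ^ 2) := by
      rw [div_pow, Real.sq_sqrt hτ0.le]
      field_simp
    have h1 : 0 < Real.sqrt (1 + δ) := Real.sqrt_pos.2 (by positivity)
    rw [pB, hsplit, hexp]
    field_simp
  simp_rw [pB_eq_gaussian hτ0, harg]
  rw [iteratedDeriv_const_mul_field,
    iteratedDeriv_comp_mul_add k (f := fun x => Real.exp (-(x ^ 2 / 2))) (by fun_prop), ← harg,
    abs_mul, abs_mul, abs_pow, abs_div, abs_of_pos hs,
    abs_of_nonneg (by positivity : 0 ≤ (Real.sqrt (2 * Real.pi * τ))⁻¹), hrpow]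
  calc _ ≤ (Real.sqrt (2 * Real.pi * τ))⁻¹ * ((|u - v| / Real.sqrt τ) ^ k * (M *
        Real.exp (-(1 / (2 * (1 + δ)) *
          ((t * u + (1 - t) * v - y) / Real.sqrt τ) ^ 2)))) := by
        gcongr
        exact h _
    _ = M * |u - v| ^ k * (Real.sqrt τ ^ k)⁻¹ *
        (Real.sqrt (1 + δ) * pB ((1 + δ) * τ) (t * u + (1 - t) * v) y) := by
        rw [hker, div_pow]
        ring
    _ = _ := by ring
end

section
/- Fix c > 0. For every nonnegative integer k and every δ ∈ (0,1) there exists a constant C'(k,δ) > 0 such that for all τ > 0, all t ∈ [0,1] and all u, v, y ∈ [0,∞), the k-th derivative in t of the function t ↦ p_R(τ; t·u+(1−t)·v, y) satisfies |d^k/dt^k p_R(τ; t·u+(1−t)·v, y)| ≤ C'(k,δ) · |u−v|^k · τ^{−k/2} · p_B((1+δ)·τ; t·u+(1−t)·v, y). -/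
open Real MeasureTheory Set

/-- Half-line Neumann heat kernel. -/
noncomputable def pN (l z z' : ℝ) : ℝ :=
  (Real.exp (-(z - z') ^ 2 / (2 * l)) + Real.exp (-(z + z') ^ 2 / (2 * l))) /
    (2 * Real.sqrt (2 * Real.pi * l))

/-- Half-line Robin heat kernel with parameter `c`. -/
noncomputable def pR (c l z z' : ℝ) : ℝ :=
  pN l z z' -
    2 * ∫ w in Set.Ioi (0 : ℝ),
      Real.exp (-w) * Real.exp (-(z + z' + w / c) ^ 2 / (2 * l)) / Real.sqrt (2 * Real.pi * l)

/-- The `n`-th derivative of the Gaussian `x ↦ exp (-(x ^ 2 / 2))`. -/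
noncomputable def gaussDeriv (n : ℕ) : ℝ → ℝ :=
  deriv^[n] fun y => Real.exp (-(y ^ 2 / 2))

lemma gaussDeriv_eq (n : ℕ) : gaussDeriv n =
    fun x => (-1 : ℝ) ^ n * Polynomial.aeval x (Polynomial.hermite n) * Real.exp (-(x ^ 2 / 2)) :=
  funext fun x => Polynomial.deriv_gaussian_eq_hermite_mul_gaussian n x

lemma gaussDeriv_zero (x : ℝ) : gaussDeriv 0 x = Real.exp (-(x ^ 2 / 2)) := rfl

lemma hasDerivAt_gaussDeriv (n : ℕ) (x : ℝ) :
    HasDerivAt (gaussDeriv n) (gaussDeriv (n + 1) x) x := by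
  have h : DifferentiableAt ℝ (gaussDeriv n) x := by
    rw [gaussDeriv_eq]
    have := (Polynomial.hermite n).differentiable_aeval (𝕜 := ℝ)
    fun_prop
  have h' : gaussDeriv (n + 1) x = deriv (gaussDeriv n) x := by
    simp only [gaussDeriv, Function.iterate_succ_apply']
  rw [h']
  exact h.hasDerivAt

@[fun_prop]
lemma continuous_gaussDeriv (n : ℕ) : Continuous (gaussDeriv n) :=
  continuous_iff_continuousAt.2 fun x => (hasDerivAt_gaussDeriv n x).continuousAt

/-- A polynomial grows slower than any Gaussian decays. -/
lemma exists_abs_aeval_le_mul_exp_sq (p : Polynomial ℤ) {ε : ℝ} (hε : 0 < ε) :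
    ∃ C > 0, ∀ x : ℝ, |Polynomial.aeval x p| ≤ C * Real.exp (ε * x ^ 2) := by
  induction p using Polynomial.induction_on' with
  | add p q hp hq =>
    obtain ⟨C, hC, hp⟩ := hp
    obtain ⟨D, hD, hq⟩ := hq
    refine ⟨C + D, by positivity, fun x => ?_⟩
    rw [map_add, add_mul]
    exact (abs_add_le _ _).trans (add_le_add (hp x) (hq x))
  | monomial n a =>
    refine ⟨(|(a : ℝ)| + 1) * (n.factorial * Real.exp (1 / (4 * ε))), by positivity, fun x => ?_⟩
    have h1 : |x| ^ n ≤ n.factorial * Real.exp |x| := by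
      have := Real.pow_div_factorial_le_exp |x| (abs_nonneg x) n
      rwa [div_le_iff₀' (by positivity)] at this
    have h2 : |x| ≤ 1 / (4 * ε) + ε * x ^ 2 := by
      have h3 : 1 / (4 * ε) + ε * x ^ 2 - |x| = ε * (|x| - 1 / (2 * ε)) ^ 2 := by
        rw [← sq_abs x]
        field_simp
        ring
      have : 0 ≤ ε * (|x| - 1 / (2 * ε)) ^ 2 := by positivity
      linarith
    have h4 : |x| ^ n ≤ n.factorial * Real.exp (1 / (4 * ε)) * Real.exp (ε * x ^ 2) := by
      rw [mul_assoc, ← Real.exp_add]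
      exact h1.trans (by gcongr)
    rw [Polynomial.aeval_monomial, abs_mul, abs_pow, mul_assoc (|(a : ℝ)| + 1)]
    refine mul_le_mul ?_ h4 (by positivity) (by positivity)
    simp

lemma exists_abs_gaussDeriv_le (n : ℕ) {δ : ℝ} (hδ : 0 < δ) :
    ∃ C > 0, ∀ x, |gaussDeriv n x| ≤ C * Real.exp (-x ^ 2 / (2 * (1 + δ))) := by
  obtain ⟨C, hC, h⟩ := exists_abs_aeval_le_mul_exp_sq (Polynomial.hermite n)
    (show 0 < δ / (2 * (1 + δ)) by positivity)
  refine ⟨C, hC, fun x => ?_⟩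
  have hx : -x ^ 2 / (2 * (1 + δ)) = δ / (2 * (1 + δ)) * x ^ 2 + -(x ^ 2 / 2) := by
    field_simp
    ring
  rw [gaussDeriv_eq, hx, Real.exp_add, ← mul_assoc]
  simp only [abs_mul, abs_pow, abs_neg, abs_one, one_pow, one_mul, Real.abs_exp]
  gcongr
  exact h x

lemma exists_abs_gaussDeriv_le_const (n : ℕ) : ∃ C > 0, ∀ x, |gaussDeriv n x| ≤ C := by
  obtain ⟨C, hC, h⟩ := exists_abs_gaussDeriv_le n one_pos
  refine ⟨C, hC, fun x => (h x).trans (mul_le_of_le_one_right hC.le (Real.exp_le_one_iff.2 ?_))⟩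
  rw [neg_div]
  exact neg_nonpos.2 (by positivity)

lemma integrableOn_exp_neg_mul_gaussDeriv (n : ℕ) (b d : ℝ) :
    IntegrableOn (fun w => Real.exp (-w) * gaussDeriv n (b + d * w)) (Set.Ioi 0) := by
  obtain ⟨C, -, h⟩ := exists_abs_gaussDeriv_le_const n
  exact (integrableOn_exp_neg_Ioi 0).mul_bdd (c := C) (by fun_prop) (ae_of_all _ fun w => h _)

lemma hasDerivAt_integral_exp_neg_mul_gaussDeriv (n : ℕ) (a b d s : ℝ) :
    HasDerivAt (fun s => ∫ w in Set.Ioi (0 : ℝ), Real.exp (-w) * gaussDeriv n (a * s + b + d * w))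
      (a * ∫ w in Set.Ioi (0 : ℝ), Real.exp (-w) * gaussDeriv (n + 1) (a * s + b + d * w)) s := by
  obtain ⟨C, -, hC⟩ := exists_abs_gaussDeriv_le_const (n + 1)
  rw [← integral_const_mul]
  refine (hasDerivAt_integral_of_dominated_loc_of_deriv_le (μ := volume.restrict (Set.Ioi 0))
    (F := fun s w => Real.exp (-w) * gaussDeriv n (a * s + b + d * w))
    (F' := fun s w => a * (Real.exp (-w) * gaussDeriv (n + 1) (a * s + b + d * w)))
    (bound := fun w => |a| * (Real.exp (-w) * C)) (s := Set.univ) Filter.univ_mem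
    (Filter.Eventually.of_forall fun s => Continuous.aestronglyMeasurable (by fun_prop))
    (integrableOn_exp_neg_mul_gaussDeriv n _ d)
    (Continuous.aestronglyMeasurable (by fun_prop)) (ae_of_all _ fun w x _ => ?_)
    (((integrableOn_exp_neg_Ioi 0).mul_const C).const_mul _) (ae_of_all _ fun w x _ => ?_)).2
  · rw [Real.norm_eq_abs, abs_mul, abs_mul, Real.abs_exp]
    gcongr
    exact hC _
  · have h : HasDerivAt (fun x => a * x + b + d * w) a x := by
      simpa using (((hasDerivAt_id x).const_mul a).add_const b).add_const (d * w)
    exact (((hasDerivAt_gaussDeriv n _).comp x h).const_mul (Real.exp (-w))).congr_deriv (by ring)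

/-- The `n`-th derivative of the Robin kernel along a line, in rescaled coordinates. -/
noncomputable def robinDeriv (q a b b' d : ℝ) (n : ℕ) (s : ℝ) : ℝ :=
  a ^ n * ((gaussDeriv n (a * s + b) + gaussDeriv n (a * s + b')) / (2 * q) -
    2 / q * ∫ w in Set.Ioi (0 : ℝ), Real.exp (-w) * gaussDeriv n (a * s + b' + d * w))

lemma hasDerivAt_robinDeriv (q a b b' d : ℝ) (n : ℕ) (s : ℝ) :
    HasDerivAt (robinDeriv q a b b' d n) (robinDeriv q a b b' d (n + 1) s) s := by
  have h (b : ℝ) : HasDerivAt (fun x => gaussDeriv n (a * x + b))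
      (gaussDeriv (n + 1) (a * s + b) * a) s :=
    (hasDerivAt_gaussDeriv n _).comp s
      (by simpa using ((hasDerivAt_id s).const_mul a).add_const b)
  refine (((((h b).add (h b')).div_const (2 * q)).sub
    ((hasDerivAt_integral_exp_neg_mul_gaussDeriv n a b' d s).const_mul (2 / q))).const_mul
      (a ^ n)).congr_deriv ?_
  rw [robinDeriv]
  ring

lemma iteratedDeriv_robinDeriv_zero (q a b b' d : ℝ) (n : ℕ) :
    iteratedDeriv n (robinDeriv q a b b' d 0) = robinDeriv q a b b' d n := by
  induction n with
  | zero => exact iteratedDeriv_zero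
  | succ n ih =>
    rw [iteratedDeriv_succ, ih]
    exact funext fun s => (hasDerivAt_robinDeriv q a b b' d n s).deriv

lemma pR_segment_eq_robinDeriv {c τ : ℝ} (hc : 0 < c) (hτ : 0 < τ) (u v y : ℝ) :
    (fun s => pR c τ (s * u + (1 - s) * v) y) =
      robinDeriv (√(2 * π * τ)) ((u - v) / √τ) ((v - y) / √τ) ((v + y) / √τ) (1 / (c * √τ)) 0 := by
  funext s
  have hr : 0 < √τ := Real.sqrt_pos.2 hτ
  have h (x z : ℝ) (hx : x = z / √τ) : gaussDeriv 0 x = Real.exp (-z ^ 2 / (2 * τ)) := by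
    rw [gaussDeriv_zero, hx, div_pow, Real.sq_sqrt hτ.le]
    congr 1
    field_simp
  simp only [pR, pN, robinDeriv, pow_zero, one_mul]
  rw [h _ (s * u + (1 - s) * v - y) (by ring), h _ (s * u + (1 - s) * v + y) (by ring),
    div_mul_eq_mul_div, mul_div_assoc, ← integral_div]
  congr 3
  funext w
  rw [h _ (s * u + (1 - s) * v + y + w / c) (by field_simp; ring)]

lemma abs_robinDeriv_le {q a b b' d s M : ℝ} {n : ℕ} (hq : 0 < q)
    (h : |gaussDeriv n (a * s + b)| ≤ M) (h' : |gaussDeriv n (a * s + b')| ≤ M)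
    (hI : ∀ w > 0, |gaussDeriv n (a * s + b' + d * w)| ≤ M) :
    |robinDeriv q a b b' d n s| ≤ 3 * |a| ^ n * (M / q) := by
  have hint : |∫ w in Set.Ioi (0 : ℝ), Real.exp (-w) * gaussDeriv n (a * s + b' + d * w)| ≤ M := by
    have hle := norm_integral_le_of_norm_le
      (f := fun w => Real.exp (-w) * gaussDeriv n (a * s + b' + d * w))
      (μ := volume.restrict (Set.Ioi 0)) ((integrableOn_exp_neg_Ioi 0).mul_const M)
      ((ae_restrict_iff' measurableSet_Ioi).2 (ae_of_all _ fun w hw => by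
        rw [Real.norm_eq_abs, abs_mul, Real.abs_exp]
        gcongr
        exact hI w hw))
    rwa [integral_mul_const, integral_exp_neg_Ioi_zero, one_mul, Real.norm_eq_abs] at hle
  rw [robinDeriv, abs_mul, abs_pow, mul_comm 3, mul_assoc]
  gcongr
  calc _ ≤ |(gaussDeriv n (a * s + b) + gaussDeriv n (a * s + b')) / (2 * q)| +
        |2 / q * ∫ w in Set.Ioi (0 : ℝ), Real.exp (-w) * gaussDeriv n (a * s + b' + d * w)| :=
      abs_sub _ _
    _ ≤ (M + M) / (2 * q) + 2 / q * M := by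
      rw [abs_div, abs_of_pos (show 0 < 2 * q by positivity), abs_mul,
        abs_of_pos (show 0 < 2 / q by positivity)]
      gcongr
      exact (abs_add_le _ _).trans (add_le_add h h')
    _ = 3 * (M / q) := by
      field_simp
      ring

theorem deriv_robin_kernel_bound (c : ℝ) (hc : 0 < c) (k : ℕ) (δ : ℝ)
    (hδ : δ ∈ Set.Ioo (0 : ℝ) 1) :
    ∃ C > 0, ∀ τ > (0 : ℝ), ∀ t ∈ Set.Icc (0 : ℝ) 1,
      ∀ u ∈ Set.Ici (0 : ℝ), ∀ v ∈ Set.Ici (0 : ℝ), ∀ y ∈ Set.Ici (0 : ℝ),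
        |iteratedDeriv k (fun s => pR c τ (s * u + (1 - s) * v) y) t| ≤
          C * |u - v| ^ k * τ ^ (-(k : ℝ) / 2) *
            pB ((1 + δ) * τ) (t * u + (1 - t) * v) y := by
  have hδ0 : 0 < δ := hδ.1
  obtain ⟨C, hC, hG⟩ := exists_abs_gaussDeriv_le k hδ0
  refine ⟨3 * C * √(1 + δ), by positivity, ?_⟩
  intro τ hτ t ht u hu v hv y hy
  have hr : 0 < √τ := Real.sqrt_pos.2 hτ
  have hy0 : 0 ≤ y := hy
  set z := t * u + (1 - t) * v with hz
  have hz0 : 0 ≤ z := add_nonneg (mul_nonneg ht.1 hu) (mul_nonneg (sub_nonneg.2 ht.2) hv)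
  have hbound (x x' : ℝ) (hx : x = x' / √τ) (hx' : (z - y) ^ 2 ≤ x' ^ 2) :
      |gaussDeriv k x| ≤ C * Real.exp (-(z - y) ^ 2 / (2 * ((1 + δ) * τ))) := by
    refine (hG x).trans ?_
    have h : -x ^ 2 / (2 * (1 + δ)) = -x' ^ 2 / (2 * ((1 + δ) * τ)) := by
      rw [hx, div_pow, Real.sq_sqrt hτ.le]
      field_simp
    rw [h]
    gcongr
  rw [pR_segment_eq_robinDeriv hc hτ, iteratedDeriv_robinDeriv_zero]
  refine (abs_robinDeriv_le (by positivity) (hbound _ (z - y) (by rw [hz]; ring) le_rfl)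
    (hbound _ (z + y) (by rw [hz]; ring) (by nlinarith)) fun w hw =>
      hbound _ (z + y + w / c) (by rw [hz]; field_simp; ring) ?_).trans_eq ?_
  · have hwc : 0 < w / c := div_pos hw hc
    exact sq_le_sq' (by linarith) (by linarith)
  · have hpow : τ ^ (-(k : ℝ) / 2) = (√τ ^ k)⁻¹ := by
      rw [Real.sqrt_eq_rpow, ← Real.rpow_natCast, ← Real.rpow_mul hτ.le, ← Real.rpow_neg hτ.le]
      congr 1
      ring
    have hsqrt : √(2 * π * ((1 + δ) * τ)) = √(1 + δ) * √(2 * π * τ) := by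
      rw [← Real.sqrt_mul (by positivity)]
      congr 1
      ring
    have h1 : 0 < √(1 + δ) := Real.sqrt_pos.2 (by positivity)
    rw [pB, hpow, hsqrt, abs_div, abs_of_pos hr, div_pow]
    field_simp
end

section
/- Let δ ∈ (0,1/2), set b = 2(1+2δ)/(1−2δ), and let δ' ∈ (0,1). There exists a constant C(δ) > 0 such that for all τ > 0 and all 0 < Λ ≤ Λ_I with δ'·Λ² ≥ b/τ, and all z₁, z₂, y₁ ∈ [0,∞): |z₁−z₂| · p_B((1+δ)/Λ_I²; z₁, z₂) · ∫₀¹ p_B((1+δ')·τ; t·z₂+(1−t)·z₁, y₁) dt ≤ C(δ) · Λ^{−1} · p_B(2/Λ_I²; z₁, z₂) · p_B((1+δ')³·τ; z₁, y₁). -/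
open Real MeasureTheory Set

lemma pB_nonneg (τ z z' : ℝ) : 0 ≤ pB τ z z' := by
  unfold pB
  positivity

/-- Shifting the starting point of the heat kernel by at most `|d|` costs a Gaussian factor in `d`
once the time is enlarged by the factor `(1 + s) ^ 2`. -/
lemma pB_shift_le {s τ : ℝ} (hs : 0 < s) (hτ : 0 < τ) {d e : ℝ} (he : e ^ 2 ≤ d ^ 2) (z y : ℝ) :
    pB ((1 + s) * τ) (z + e) y ≤
      (1 + s) * Real.exp (d ^ 2 / (4 * s * τ)) * pB ((1 + s) ^ 3 * τ) z y := by
  have hsqrt : √(2 * π * ((1 + s) ^ 3 * τ)) = (1 + s) * √(2 * π * ((1 + s) * τ)) := by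
    rw [show 2 * π * ((1 + s) ^ 3 * τ) = (1 + s) ^ 2 * (2 * π * ((1 + s) * τ)) by ring,
      Real.sqrt_mul (by positivity), Real.sqrt_sq (by positivity)]
  have hpos : 0 < √(2 * π * ((1 + s) * τ)) := by positivity
  have hexp : -(z + e - y) ^ 2 / (2 * ((1 + s) * τ)) ≤
      d ^ 2 / (4 * s * τ) + -(z - y) ^ 2 / (2 * ((1 + s) ^ 3 * τ)) := by
    rw [← sub_nonneg]
    have key : d ^ 2 / (4 * s * τ) + -(z - y) ^ 2 / (2 * ((1 + s) ^ 3 * τ)) -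
        -(z + e - y) ^ 2 / (2 * ((1 + s) * τ)) =
        ((2 * s * (z + e - y) + e) ^ 2 + 2 * s ^ 3 * (z + e - y) ^ 2 +
          (3 * s ^ 2 + s ^ 3 + s) * e ^ 2 + (1 + s) ^ 3 * (d ^ 2 - e ^ 2)) /
          (4 * s * (1 + s) ^ 3 * τ) := by
      field_simp
      ring
    rw [key]
    have := sub_nonneg.2 he
    positivity
  calc pB ((1 + s) * τ) (z + e) y
      ≤ Real.exp (d ^ 2 / (4 * s * τ) + -(z - y) ^ 2 / (2 * ((1 + s) ^ 3 * τ))) /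
          √(2 * π * ((1 + s) * τ)) := by
        unfold pB
        gcongr
    _ = (1 + s) * Real.exp (d ^ 2 / (4 * s * τ)) * pB ((1 + s) ^ 3 * τ) z y := by
        unfold pB
        rw [hsqrt, Real.exp_add]
        field_simp

lemma mul_exp_neg_mul_sq_le {c : ℝ} (hc : 0 < c) (hc1 : c ≤ 1) (x : ℝ) :
    x * Real.exp (-(c * x ^ 2)) ≤ 1 / c := by
  rw [Real.exp_neg, ← div_eq_mul_inv, div_le_div_iff₀ (Real.exp_pos _) hc]
  nlinarith [Real.add_one_le_exp (c * x ^ 2), mul_nonneg hc.le (sq_nonneg (x - 1)),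
    mul_nonneg hc.le (sq_nonneg x)]

/-- The spatial increment and a small Gaussian growth are absorbed by enlarging the time
from `(1 + δ) / L ^ 2` to `2 / L ^ 2`. -/
lemma abs_mul_pB_mul_exp_le {δ L : ℝ} (hδ : 0 < δ) (hδ' : δ < 1 / 2) (hL : 0 < L) (z z' : ℝ) :
    |z - z'| * pB ((1 + δ) / L ^ 2) z z' *
        Real.exp ((z - z') ^ 2 * L ^ 2 * ((1 - 2 * δ) / (8 * (1 + 2 * δ)))) ≤
      2 * (8 * (1 + δ) / (1 - δ)) * L⁻¹ * pB (2 / L ^ 2) z z' := by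
  have h1 : 0 < 1 - δ := by linarith
  set c : ℝ := (1 - δ) / (8 * (1 + δ)) with hc
  set w : ℝ := |z - z'| with hw
  have hw2 : (z - z') ^ 2 = w ^ 2 := (sq_abs _).symm
  have hw0 : 0 ≤ w := abs_nonneg _
  have hc0 : 0 < c := by positivity
  have hc1 : c ≤ 1 := by
    rw [hc, div_le_one (by positivity)]
    linarith
  have hrate : (1 - 2 * δ) / (8 * (1 + 2 * δ)) ≤ c := by
    rw [hc, div_le_div_iff₀ (by positivity) (by positivity)]
    nlinarith
  have hmain : w * Real.exp (-(c * (w * L) ^ 2)) ≤ 1 / c * L⁻¹ := by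
    rw [← div_eq_mul_inv, le_div_iff₀ hL]
    linarith [mul_exp_neg_mul_sq_le hc0 hc1 (w * L)]
  have hexp : -(z - z') ^ 2 / (2 * ((1 + δ) / L ^ 2)) +
      (z - z') ^ 2 * L ^ 2 * ((1 - 2 * δ) / (8 * (1 + 2 * δ))) ≤
      -(c * (w * L) ^ 2) + -(z - z') ^ 2 / (2 * (2 / L ^ 2)) := by
    have e1 : -(z - z') ^ 2 / (2 * ((1 + δ) / L ^ 2)) =
        -(2 * c * (w * L) ^ 2) + -(z - z') ^ 2 / (2 * (2 / L ^ 2)) := by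
      rw [hw2, hc]
      field_simp
      ring
    rw [e1, hw2]
    have := mul_le_mul_of_nonneg_left hrate (sq_nonneg (w * L))
    rw [mul_pow] at *
    linarith
  have hsqrt : √(2 * π * (2 / L ^ 2)) ≤ 2 * √(2 * π * ((1 + δ) / L ^ 2)) := by
    rw [Real.sqrt_le_left (by positivity), mul_pow, Real.sq_sqrt (by positivity)]
    have : 2 / L ^ 2 ≤ 4 * ((1 + δ) / L ^ 2) := by
      rw [mul_div_assoc']
      gcongr
      linarith
    nlinarith [Real.pi_pos]
  have hA : 0 < √(2 * π * ((1 + δ) / L ^ 2)) := by positivity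
  have hB : 0 < √(2 * π * (2 / L ^ 2)) := by positivity
  have hinv : 1 / √(2 * π * ((1 + δ) / L ^ 2)) ≤ 2 / √(2 * π * (2 / L ^ 2)) := by
    rw [div_le_div_iff₀ hA hB]
    linarith
  calc w * pB ((1 + δ) / L ^ 2) z z' *
        Real.exp ((z - z') ^ 2 * L ^ 2 * ((1 - 2 * δ) / (8 * (1 + 2 * δ))))
      = w * Real.exp (-(z - z') ^ 2 / (2 * ((1 + δ) / L ^ 2)) +
          (z - z') ^ 2 * L ^ 2 * ((1 - 2 * δ) / (8 * (1 + 2 * δ)))) *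
          (1 / √(2 * π * ((1 + δ) / L ^ 2))) := by
        unfold pB
        rw [Real.exp_add]
        ring
    _ ≤ w * Real.exp (-(c * (w * L) ^ 2) + -(z - z') ^ 2 / (2 * (2 / L ^ 2))) *
          (2 / √(2 * π * (2 / L ^ 2))) := by
        gcongr
    _ = 2 * (w * Real.exp (-(c * (w * L) ^ 2))) * pB (2 / L ^ 2) z z' := by
        unfold pB
        rw [Real.exp_add]
        ring
    _ ≤ 2 * (1 / c * L⁻¹) * pB (2 / L ^ 2) z z' := by
        have := pB_nonneg (2 / L ^ 2) z z'
        gcongr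
    _ = 2 * (8 * (1 + δ) / (1 - δ)) * L⁻¹ * pB (2 / L ^ 2) z z' := by
        rw [hc, one_div_div]
        ring

theorem heat_kernel_telescope_bound (δ : ℝ) (hδ : δ ∈ Set.Ioo (0 : ℝ) (1 / 2)) :
    ∃ C > 0, ∀ δ' ∈ Set.Ioo (0 : ℝ) 1, ∀ τ > (0 : ℝ), ∀ Λ ΛI : ℝ,
      0 < Λ → Λ ≤ ΛI → δ' * Λ ^ 2 ≥ (2 * (1 + 2 * δ) / (1 - 2 * δ)) / τ →
      ∀ z₁ ∈ Set.Ici (0 : ℝ), ∀ z₂ ∈ Set.Ici (0 : ℝ), ∀ y₁ ∈ Set.Ici (0 : ℝ),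
        |z₁ - z₂| * pB ((1 + δ) / ΛI ^ 2) z₁ z₂ *
            ∫ t in (0 : ℝ)..1, pB ((1 + δ') * τ) (t * z₂ + (1 - t) * z₁) y₁ ≤
          C * Λ⁻¹ * pB (2 / ΛI ^ 2) z₁ z₂ * pB ((1 + δ') ^ 3 * τ) z₁ y₁ := by
  obtain ⟨hδ0, hδ1⟩ := hδ
  have h1 : 0 < 1 - δ := by linarith
  have h2 : 0 < 1 - 2 * δ := by linarith
  refine ⟨2 * (2 * (8 * (1 + δ) / (1 - δ))), by positivity, ?_⟩
  rintro s ⟨hs0, hs1⟩ τ hτ Λ L hΛ hΛL hb z₁ - z₂ - y₁ -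
  have hL : 0 < L := hΛ.trans_le hΛL
  have hP := pB_nonneg ((1 + s) ^ 3 * τ) z₁ y₁
  have hQ := pB_nonneg ((1 + δ) / L ^ 2) z₁ z₂
  have hR := pB_nonneg (2 / L ^ 2) z₁ z₂
  set E : ℝ := Real.exp ((z₁ - z₂) ^ 2 * L ^ 2 * ((1 - 2 * δ) / (8 * (1 + 2 * δ)))) with hE
  have hτL : (z₁ - z₂) ^ 2 / (4 * s * τ) ≤
      (z₁ - z₂) ^ 2 * L ^ 2 * ((1 - 2 * δ) / (8 * (1 + 2 * δ))) := by
    have hsq : Λ ^ 2 ≤ L ^ 2 := by gcongr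
    have hb' : 2 * (1 + 2 * δ) ≤ s * L ^ 2 * τ * (1 - 2 * δ) := by
      rw [ge_iff_le, div_le_iff₀ hτ, div_le_iff₀ h2] at hb
      refine hb.trans ?_
      gcongr
    rw [div_le_iff₀ (by positivity)]
    have h3 : 1 ≤ L ^ 2 * ((1 - 2 * δ) / (8 * (1 + 2 * δ))) * (4 * s * τ) := by
      rw [mul_div_assoc', div_mul_eq_mul_div, one_le_div (by positivity)]
      linarith
    nlinarith [mul_le_mul_of_nonneg_left h3 (sq_nonneg (z₁ - z₂))]
  have hint : ∫ t in (0 : ℝ)..1, pB ((1 + s) * τ) (t * z₂ + (1 - t) * z₁) y₁ ≤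
      2 * E * pB ((1 + s) ^ 3 * τ) z₁ y₁ := by
    refine (Real.le_norm_self _).trans ?_
    have hbound := intervalIntegral.norm_integral_le_of_norm_le_const
      (a := (0 : ℝ)) (b := 1) (C := 2 * E * pB ((1 + s) ^ 3 * τ) z₁ y₁)
      (f := fun t => pB ((1 + s) * τ) (t * z₂ + (1 - t) * z₁) y₁) ?_
    · simpa using hbound
    intro t ht
    rw [Set.uIoc_of_le zero_le_one] at ht
    rw [Real.norm_of_nonneg (pB_nonneg _ _ _),
      show t * z₂ + (1 - t) * z₁ = z₁ + t * (z₂ - z₁) by ring]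
    have ht2 : (t * (z₂ - z₁)) ^ 2 ≤ (z₁ - z₂) ^ 2 := by
      have : t ^ 2 ≤ 1 := pow_le_one₀ ht.1.le ht.2
      nlinarith [mul_le_mul_of_nonneg_right this (sq_nonneg (z₁ - z₂))]
    refine (pB_shift_le hs0 hτ ht2 z₁ y₁).trans ?_
    gcongr
    · linarith
    · exact Real.exp_le_exp.2 hτL
  calc |z₁ - z₂| * pB ((1 + δ) / L ^ 2) z₁ z₂ *
        ∫ t in (0 : ℝ)..1, pB ((1 + s) * τ) (t * z₂ + (1 - t) * z₁) y₁
      ≤ |z₁ - z₂| * pB ((1 + δ) / L ^ 2) z₁ z₂ * (2 * E * pB ((1 + s) ^ 3 * τ) z₁ y₁) := by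
        gcongr
    _ = 2 * (|z₁ - z₂| * pB ((1 + δ) / L ^ 2) z₁ z₂ * E) * pB ((1 + s) ^ 3 * τ) z₁ y₁ := by
        ring
    _ ≤ 2 * (2 * (8 * (1 + δ) / (1 - δ)) * L⁻¹ * pB (2 / L ^ 2) z₁ z₂) *
          pB ((1 + s) ^ 3 * τ) z₁ y₁ := by
        exact mul_le_mul_of_nonneg_right
          (mul_le_mul_of_nonneg_left (abs_mul_pB_mul_exp_le hδ0 hδ1 hL z₁ z₂) zero_le_two) hP
    _ ≤ 2 * (2 * (8 * (1 + δ) / (1 - δ)) * Λ⁻¹ * pB (2 / L ^ 2) z₁ z₂) *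
          pB ((1 + s) ^ 3 * τ) z₁ y₁ := by
        gcongr
    _ = 2 * (2 * (8 * (1 + δ) / (1 - δ))) * Λ⁻¹ * pB (2 / L ^ 2) z₁ z₂ *
          pB ((1 + s) ^ 3 * τ) z₁ y₁ := by
        ring
end

section
/- For every μ > 0 and every real a: ∫₀^∞ e^{−λμ²} · (2πλ)^{−1/2} · exp(−a²/(2λ)) dλ ≤ e^{−μ·|a|}/μ. -/
open Real MeasureTheory Set

theorem integral_exp_neg_mul_div_sqrt (μ : ℝ) (hμ : 0 < μ) :
    ∫ l in Ioi (0 : ℝ), exp (-(l * μ ^ 2 / 2)) / √(2 * π * l) = 1 / μ := by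
  have h := Real.integral_rpow_mul_exp_neg_mul_Ioi (a := 1 / 2) (r := μ ^ 2 / 2)
    (by norm_num) (by positivity)
  have hcongr : ∀ l ∈ Ioi (0 : ℝ), exp (-(l * μ ^ 2 / 2)) / √(2 * π * l) =
      (√(2 * π))⁻¹ * (l ^ ((1 : ℝ) / 2 - 1) * exp (-(μ ^ 2 / 2 * l))) := by
    intro l hl
    have hl : 0 < l := hl
    rw [show (1 : ℝ) / 2 - 1 = -(1 / 2) by norm_num, rpow_neg hl.le, ← sqrt_eq_rpow,
      sqrt_mul (by positivity), show μ ^ 2 / 2 * l = l * μ ^ 2 / 2 by ring]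
    field_simp
  rw [setIntegral_congr_fun measurableSet_Ioi hcongr, integral_const_mul, h, Gamma_one_half_eq,
    ← sqrt_eq_rpow, sqrt_mul (by norm_num), one_div_div, sqrt_div (by norm_num), sqrt_sq hμ.le]
  field_simp

theorem heat_kernel_mul_exp_le (μ a l : ℝ) (hl : 0 < l) :
    exp (-(l * μ ^ 2)) * (exp (-a ^ 2 / (2 * l)) / √(2 * π * l)) ≤
      exp (-(μ * |a|)) * (exp (-(l * μ ^ 2 / 2)) / √(2 * π * l)) := by
  rw [← mul_div_assoc, ← mul_div_assoc, ← exp_add, ← exp_add]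
  refine div_le_div_of_nonneg_right (exp_le_exp.2 ?_) (sqrt_nonneg _)
  have h : -(μ * |a|) + -(l * μ ^ 2 / 2) - (-(l * μ ^ 2) + -a ^ 2 / (2 * l)) =
      (l * μ - |a|) ^ 2 / (2 * l) := by
    rw [← sq_abs a]
    field_simp
    ring
  have : 0 ≤ (l * μ - |a|) ^ 2 / (2 * l) := by positivity
  linarith

theorem laplace_transform_heat_kernel_bound (μ : ℝ) (hμ : 0 < μ) (a : ℝ) :
    (∫ l in Set.Ioi (0 : ℝ),
        Real.exp (-(l * μ ^ 2)) * (Real.exp (-a ^ 2 / (2 * l)) / Real.sqrt (2 * Real.pi * l))) ≤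
      Real.exp (-(μ * |a|)) / μ := by
  have hval := integral_exp_neg_mul_div_sqrt μ hμ
  have hint : IntegrableOn (fun l => exp (-(l * μ ^ 2 / 2)) / √(2 * π * l)) (Ioi 0) :=
    not_imp_comm.1 integral_undef (by rw [hval]; positivity)
  rw [div_eq_mul_one_div, ← hval, ← integral_const_mul]
  refine integral_mono_of_nonneg (.of_forall fun l => ?_) (hint.const_mul _) ?_
  · dsimp only [Pi.zero_apply]
    positivity
  · filter_upwards [ae_restrict_mem measurableSet_Ioi] with l hl
    exact heat_kernel_mul_exp_le μ a l hl
end
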